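/- Let 𝒳 be compact, μ a probability measure on 𝒳, ε > 0, and g : 𝒳 × 𝒴 → ℝ a function such that x ↦ g(x,y) is continuous for each y and such that all partial derivatives in y up to order s exist, are continuous, and are uniformly bounded: |D_y^α g(x,y)| ≤ M for all |α| ≤ s, uniformly in x, y. Then h(y) = -ε log ∫_𝒳 exp(g(x,y)/ε) dμ(x) is s-times continuously differentiable in y, and there is a constant C depending only on s, d and M such that |D^α h(y)| ≤ C(1 + ε^{1-s}) for all multi-indices α with 1 ≤ |α| ≤ s. -/

import Mathlib

open MeasureTheory

/-- Partial derivative in the direction of the `i`-th coordinate. -/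
noncomputable def pderiv' {d : ℕ} (i : Fin d) (g : EuclideanSpace ℝ (Fin d) → ℝ) :
    EuclideanSpace ℝ (Fin d) → ℝ :=
  fun x => fderiv ℝ g x (EuclideanSpace.single i 1)


section helpers

variable {d : ℕ}

/-- Weighted bounds on iterated partial derivatives up to order `k`. -/
def Bd {d : ℕ} (w : ℝ) : ℕ → ℝ → (EuclideanSpace ℝ (Fin d) → ℝ) → Prop
  | 0, A, F => Continuous F ∧ ∀ y, |F y| ≤ A
  | (k+1), A, F => Differentiable ℝ F ∧ (∀ y, |F y| ≤ A) ∧ ∀ i, Bd w k (A * w) (pderiv' i F)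

lemma Bd.bound {w : ℝ} {k : ℕ} {A : ℝ} {F : EuclideanSpace ℝ (Fin d) → ℝ}
    (h : Bd w k A F) (y) : |F y| ≤ A := by
  cases k with
  | zero => exact h.2 y
  | succ k => exact h.2.1 y

lemma Bd.nonneg {w : ℝ} {k : ℕ} {A : ℝ} {F : EuclideanSpace ℝ (Fin d) → ℝ}
    (h : Bd w k A F) : 0 ≤ A := (abs_nonneg _).trans (h.bound 0)

lemma Bd.continuous {w : ℝ} {k : ℕ} {A : ℝ} {F : EuclideanSpace ℝ (Fin d) → ℝ}
    (h : Bd w k A F) : Continuous F := by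
  cases k with
  | zero => exact h.1
  | succ k => exact h.1.continuous

lemma Bd.mono {w : ℝ} (hw : 0 ≤ w) {k : ℕ} : ∀ {A A' : ℝ} {F : EuclideanSpace ℝ (Fin d) → ℝ},
    Bd w k A F → A ≤ A' → Bd w k A' F := by
  induction k with
  | zero => intro A A' F h hA; exact ⟨h.1, fun y => (h.2 y).trans hA⟩
  | succ k ih =>
    intro A A' F h hA
    exact ⟨h.1, fun y => (h.2.1 y).trans hA,
      fun i => ih (h.2.2 i) (mul_le_mul_of_nonneg_right hA hw)⟩

lemma Bd.down {w : ℝ} {k : ℕ} : ∀ {A : ℝ} {F : EuclideanSpace ℝ (Fin d) → ℝ},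
    Bd w (k+1) A F → Bd w k A F := by
  induction k with
  | zero => intro A F h; exact ⟨h.1.continuous, h.2.1⟩
  | succ k ih => intro A F h; exact ⟨h.1, h.2.1, fun i => ih (h.2.2 i)⟩

lemma pderiv_add {F G : EuclideanSpace ℝ (Fin d) → ℝ} (hF : Differentiable ℝ F)
    (hG : Differentiable ℝ G) (i : Fin d) :
    pderiv' i (fun y => F y + G y) = fun y => pderiv' i F y + pderiv' i G y := by
  funext y
  simp only [pderiv']
  rw [fderiv_fun_add (hF y) (hG y)]; rfl

lemma pderiv_smul {F : EuclideanSpace ℝ (Fin d) → ℝ} (hF : Differentiable ℝ F) (c : ℝ)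
    (i : Fin d) :
    pderiv' i (fun y => c * F y) = fun y => c * pderiv' i F y := by
  funext y
  simp only [pderiv']
  rw [fderiv_const_mul (hF y)]; rfl

lemma pderiv_mul {F G : EuclideanSpace ℝ (Fin d) → ℝ} (hF : Differentiable ℝ F)
    (hG : Differentiable ℝ G) (i : Fin d) :
    pderiv' i (fun y => F y * G y) = fun y => pderiv' i F y * G y + F y * pderiv' i G y := by
  funext y
  simp only [pderiv']
  rw [fderiv_fun_mul (hF y) (hG y)]
  simp
  ring

lemma Bd.add {w : ℝ} {k : ℕ} : ∀ {A A' : ℝ} {F G : EuclideanSpace ℝ (Fin d) → ℝ},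
    Bd w k A F → Bd w k A' G → Bd w k (A + A') (fun y => F y + G y) := by
  induction k with
  | zero =>
    intro A A' F G h h'
    exact ⟨h.1.add h'.1, fun y => (abs_add_le _ _).trans (add_le_add (h.2 y) (h'.2 y))⟩
  | succ k ih =>
    intro A A' F G h h'
    refine ⟨h.1.add h'.1, fun y => (abs_add_le _ _).trans (add_le_add (h.2.1 y) (h'.2.1 y)), ?_⟩
    intro i
    rw [pderiv_add h.1 h'.1, add_mul]
    exact ih (h.2.2 i) (h'.2.2 i)

lemma Bd.smul {w : ℝ} {k : ℕ} (c : ℝ) : ∀ {A : ℝ} {F : EuclideanSpace ℝ (Fin d) → ℝ},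
    Bd w k A F → Bd w k (|c| * A) (fun y => c * F y) := by
  induction k with
  | zero =>
    intro A F h
    refine ⟨continuous_const.mul h.1, fun y => ?_⟩
    rw [abs_mul]; exact mul_le_mul_of_nonneg_left (h.2 y) (abs_nonneg _)
  | succ k ih =>
    intro A F h
    refine ⟨h.1.const_mul c, fun y => ?_, fun i => ?_⟩
    · rw [abs_mul]; exact mul_le_mul_of_nonneg_left (h.2.1 y) (abs_nonneg _)
    · rw [pderiv_smul h.1, mul_assoc]
      exact ih (h.2.2 i)

lemma Bd.mul {w : ℝ} {k : ℕ} : ∀ {A A' : ℝ} {F G : EuclideanSpace ℝ (Fin d) → ℝ},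
    Bd w k A F → Bd w k A' G → Bd w k (2 ^ k * (A * A')) (fun y => F y * G y) := by
  induction k with
  | zero =>
    intro A A' F G h h'
    refine ⟨h.1.mul h'.1, fun y => ?_⟩
    rw [abs_mul, pow_zero, one_mul]
    exact mul_le_mul (h.2 y) (h'.2 y) (abs_nonneg _) h.nonneg
  | succ k ih =>
    intro A A' F G h h'
    have hA := h.nonneg
    have hA' := h'.nonneg
    refine ⟨h.1.mul h'.1, fun y => ?_, fun i => ?_⟩
    · rw [abs_mul]
      have h1 : |F y| * |G y| ≤ A * A' :=
        mul_le_mul (h.2.1 y) (h'.2.1 y) (abs_nonneg _) hA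
      have h2 : (1:ℝ) ≤ 2 ^ (k+1) := one_le_pow₀ (by norm_num)
      nlinarith [mul_nonneg hA hA']
    · rw [pderiv_mul h.1 h'.1]
      have := (ih (h.2.2 i) h'.down).add (ih h.down (h'.2.2 i))
      have e : 2 ^ (k+1) * (A * A') * w = 2 ^ k * (A * w * A') + 2 ^ k * (A * (A' * w)) := by
        ring
      rw [e]; exact this

lemma eu_sum (v : EuclideanSpace ℝ (Fin d)) :
    v = ∑ i, v i • EuclideanSpace.single i (1:ℝ) := by
  ext j
  simp [Finset.sum_apply, Pi.single_apply]

lemma fderiv_expand (F : EuclideanSpace ℝ (Fin d) → ℝ) (y v : EuclideanSpace ℝ (Fin d)) :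
    fderiv ℝ F y v = ∑ i, v i * pderiv' i F y := by
  conv_lhs => rw [eu_sum v]
  simp [pderiv']

lemma fderiv_expand' (F : EuclideanSpace ℝ (Fin d) → ℝ) (y : EuclideanSpace ℝ (Fin d)) :
    fderiv ℝ F y = ∑ i, pderiv' i F y • (EuclideanSpace.proj i : EuclideanSpace ℝ (Fin d) →L[ℝ] ℝ) := by
  ext v
  rw [fderiv_expand]
  simp [mul_comm]

lemma contDiff_of_pderiv {k : ℕ} {F : EuclideanSpace ℝ (Fin d) → ℝ} (hF : Differentiable ℝ F)
    (h : ∀ i, ContDiff ℝ (k : ℕ∞) (pderiv' i F)) : ContDiff ℝ ((k + 1 : ℕ) : ℕ∞) F := by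
  have : (((k + 1 : ℕ) : ℕ∞) : WithTop ℕ∞) = ((k : ℕ∞) : WithTop ℕ∞) + 1 := by
    push_cast; rfl
  rw [this, contDiff_succ_iff_fderiv]
  refine ⟨hF, by simp, ?_⟩
  have e : fderiv ℝ F = fun y =>
      ∑ i, pderiv' i F y • (EuclideanSpace.proj i : EuclideanSpace ℝ (Fin d) →L[ℝ] ℝ) :=
    funext (fderiv_expand' F)
  rw [e]
  exact ContDiff.sum fun i _ => (h i).smul contDiff_const

lemma Bd.contDiff {w : ℝ} {k : ℕ} : ∀ {A : ℝ} {F : EuclideanSpace ℝ (Fin d) → ℝ},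
    Bd w k A F → ContDiff ℝ (k : ℕ∞) F := by
  induction k with
  | zero => intro A F h; simpa using h.1
  | succ k ih => intro A F h; exact contDiff_of_pderiv h.1 fun i => ih (h.2.2 i)

lemma Bd.list {w : ℝ} {k : ℕ} : ∀ {A : ℝ} {F : EuclideanSpace ℝ (Fin d) → ℝ},
    Bd w k A F → ∀ L : List (Fin d), L.length ≤ k → ∀ y,
      |(L.foldr pderiv' F) y| ≤ A * w ^ L.length := by
  induction k with
  | zero =>
    intro A F h L hL y
    obtain rfl : L = [] := List.length_eq_zero_iff.1 (by omega)
    simpa using h.2 y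
  | succ k ih =>
    intro A F h L hL y
    rcases List.eq_nil_or_concat L with rfl | ⟨L', i, rfl⟩
    · simpa using h.2.1 y
    · have := ih (h.2.2 i) L' (by simpa using hL) y
      simp only [List.concat_eq_append, List.foldr_append, List.length_append, List.foldr_cons,
        List.foldr_nil, List.length_cons, List.length_nil, zero_add]
      rw [pow_succ']
      calc _ ≤ _ := this
        _ = _ := by ring

lemma pderiv_contDiff {k : ℕ} {F : EuclideanSpace ℝ (Fin d) → ℝ}
    (h : ContDiff ℝ ((k + 1 : ℕ) : ℕ∞) F) (i : Fin d) : ContDiff ℝ (k : ℕ∞) (pderiv' i F) := by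
  have : (((k + 1 : ℕ) : ℕ∞) : WithTop ℕ∞) = ((k : ℕ∞) : WithTop ℕ∞) + 1 := by
    push_cast; rfl
  rw [this, contDiff_succ_iff_fderiv] at h
  exact h.2.2.clm_apply contDiff_const

lemma Bd.of_list {k : ℕ} : ∀ {A : ℝ} {F : EuclideanSpace ℝ (Fin d) → ℝ},
    ContDiff ℝ (k : ℕ∞) F →
    (∀ y, ∀ L : List (Fin d), L.length ≤ k → |(L.foldr pderiv' F) y| ≤ A) → Bd 1 k A F := by
  induction k with
  | zero => intro A F h hL; exact ⟨h.continuous, fun y => hL y [] (by simp)⟩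
  | succ k ih =>
    intro A F h hL
    refine ⟨h.differentiable (by simp), fun y => hL y [] (by simp), fun i => ?_⟩
    rw [mul_one]
    refine ih (pderiv_contDiff h i) fun y L hl => ?_
    have := hL y (L ++ [i]) (by simpa using hl)
    simpa [List.foldr_append] using this

variable {Ω : Type*} [MeasurableSpace Ω]

lemma meas_pderiv {u : Ω → EuclideanSpace ℝ (Fin d) → ℝ} (hm : ∀ y, Measurable fun x => u x y)
    (hd : ∀ x, Differentiable ℝ (u x)) (i : Fin d) (y : EuclideanSpace ℝ (Fin d)) :
    Measurable fun x => pderiv' i (u x) y := by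
  have hlim : ∀ x, Filter.Tendsto (fun n : ℕ => ((n:ℝ)) * (u x (y + ((n:ℝ))⁻¹ • EuclideanSpace.single i (1:ℝ)) - u x y))
      Filter.atTop (nhds (pderiv' i (u x) y)) := by
    intro x
    have h := ((hd x) y).hasFDerivAt.lim (EuclideanSpace.single i (1:ℝ)) (α := ℕ)
      (l := Filter.atTop) (c := fun n => (n:ℝ)) ?_
    · exact h
    · exact tendsto_norm_atTop_atTop.comp tendsto_natCast_atTop_atTop
  refine measurable_of_tendsto_metrizable (f := fun n x => ((n:ℝ)) * (u x (y + ((n:ℝ))⁻¹ • EuclideanSpace.single i (1:ℝ)) - u x y)) ?_ (tendsto_pi_nhds.2 hlim)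
  intro n
  exact ((hm _).sub (hm _)).const_mul _

lemma int_bdd {μ : Measure Ω} [IsProbabilityMeasure μ] {f : Ω → ℝ} (hm : Measurable f) {B : ℝ}
    (hb : ∀ x, |f x| ≤ B) : Integrable f μ :=
  Integrable.of_bound hm.aestronglyMeasurable B (Filter.Eventually.of_forall hb)

lemma int_cont {μ : Measure Ω} [IsProbabilityMeasure μ]
    {u : Ω → EuclideanSpace ℝ (Fin d) → ℝ} (hm : ∀ y, Measurable fun x => u x y)
    (hc : ∀ x, Continuous (u x)) {B : ℝ} (hb : ∀ x y, |u x y| ≤ B) :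
    Continuous fun y => ∫ x, u x y ∂μ :=
  continuous_of_dominated (bound := fun _ => B) (fun y => (hm y).aestronglyMeasurable)
    (fun y => Filter.Eventually.of_forall fun x => hb x y) (integrable_const _)
    (Filter.Eventually.of_forall hc)

lemma int_deriv {μ : Measure Ω} [IsProbabilityMeasure μ]
    {u : Ω → EuclideanSpace ℝ (Fin d) → ℝ} (hm : ∀ y, Measurable fun x => u x y)
    (hd : ∀ x, Differentiable ℝ (u x)) {B B' : ℝ} (hb : ∀ x y, |u x y| ≤ B)
    (hb' : ∀ i x y, |pderiv' i (u x) y| ≤ B') :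
    Differentiable ℝ (fun y => ∫ x, u x y ∂μ) ∧
      ∀ i y, pderiv' i (fun y => ∫ x, u x y ∂μ) y = ∫ x, pderiv' i (u x) y ∂μ := by
  have hmeas : ∀ y, Measurable fun x => fderiv ℝ (u x) y := by
    intro y
    simp_rw [fderiv_expand']
    refine Finset.measurable_fun_sum _ fun i _ => ?_
    exact (meas_pderiv hm hd i y).smul_const _
  have hbound : ∀ x y, ‖fderiv ℝ (u x) y‖ ≤
      ∑ i : Fin d, B' * ‖(EuclideanSpace.proj i : EuclideanSpace ℝ (Fin d) →L[ℝ] ℝ)‖ := by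
    intro x y
    rw [fderiv_expand']
    refine (norm_sum_le _ _).trans (Finset.sum_le_sum fun i _ => ?_)
    rw [norm_smul]
    exact mul_le_mul_of_nonneg_right (hb' i x y) (norm_nonneg _)
  have key : ∀ y, HasFDerivAt (fun y => ∫ x, u x y ∂μ) (∫ x, fderiv ℝ (u x) y ∂μ) y := by
    intro y
    exact hasFDerivAt_integral_of_dominated_of_fderiv_le (s := Set.univ) Filter.univ_mem
      (Filter.Eventually.of_forall fun y => (hm y).aestronglyMeasurable)
      (int_bdd (hm y) fun x => hb x y) (hmeas y).aestronglyMeasurable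
      (Filter.Eventually.of_forall fun x y _ => hbound x y) (integrable_const _)
      (Filter.Eventually.of_forall fun x y _ => (hd x y).hasFDerivAt)
  refine ⟨fun y => (key y).differentiableAt, fun i y => ?_⟩
  have hI : Integrable (fun x => fderiv ℝ (u x) y) μ :=
    Integrable.of_bound (hmeas y).aestronglyMeasurable _
      (Filter.Eventually.of_forall fun x => hbound x y)
  simp only [pderiv']
  rw [(key y).fderiv, ContinuousLinearMap.integral_apply hI]

/-- Gibbs average of `f`. -/
noncomputable def Ex (μ : Measure Ω) (ε : ℝ) (g f : Ω → EuclideanSpace ℝ (Fin d) → ℝ)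
    (y : EuclideanSpace ℝ (Fin d)) : ℝ :=
  (∫ x, f x y * Real.exp (g x y / ε) ∂μ) / ∫ x, Real.exp (g x y / ε) ∂μ

lemma exp_bd {ε M a : ℝ} (hε : 0 < ε) (h : |a| ≤ M) :
    |Real.exp (a / ε)| ≤ Real.exp (M / ε) := by
  rw [abs_of_pos (Real.exp_pos _)]
  gcongr
  exact (abs_le.1 h).2

lemma Z_pos {μ : Measure Ω} [IsProbabilityMeasure μ] {ε M : ℝ} (hε : 0 < ε) {a : Ω → ℝ}
    (ha : Measurable a) (hb : ∀ x, |a x| ≤ M) : 0 < ∫ x, Real.exp (a x / ε) ∂μ :=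
  integral_exp_pos (int_bdd (by fun_prop) fun x => exp_bd hε (hb x))

lemma Ex_bound {μ : Measure Ω} [IsProbabilityMeasure μ] {ε M B : ℝ} (hε : 0 < ε)
    {g f : Ω → EuclideanSpace ℝ (Fin d) → ℝ}
    (hg : ∀ y, Measurable fun x => g x y) (hgb : ∀ x y, |g x y| ≤ M)
    (hfb : ∀ x y, |f x y| ≤ B) (y) : |Ex μ ε g f y| ≤ B := by
  have hZ := Z_pos (μ := μ) hε (hg y) (fun x => hgb x y)
  have hgy := hg y
  unfold Ex
  rw [abs_div, abs_of_pos hZ, div_le_iff₀ hZ, ← integral_const_mul]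
  have hI : Integrable (fun x => Real.exp (g x y / ε)) μ :=
    int_bdd (by fun_prop) fun x => exp_bd hε (hgb x y)
  rw [← Real.norm_eq_abs]
  refine norm_integral_le_of_norm_le (hI.const_mul B) (Filter.Eventually.of_forall fun x => ?_)
  rw [Real.norm_eq_abs, abs_mul, abs_of_pos (Real.exp_pos _)]
  exact mul_le_mul_of_nonneg_right (hfb x y) (Real.exp_pos _).le

lemma pderiv_fexp {ε : ℝ} {F G : EuclideanSpace ℝ (Fin d) → ℝ} (hF : Differentiable ℝ F)
    (hG : Differentiable ℝ G) (i : Fin d) (y) :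
    pderiv' i (fun y => F y * Real.exp (G y / ε)) y =
      pderiv' i F y * Real.exp (G y / ε) + ε⁻¹ * (F y * pderiv' i G y * Real.exp (G y / ε)) := by
  have h := (hF y).hasFDerivAt.mul (((hG y).hasFDerivAt.mul_const ε⁻¹).exp)
  simp only [pderiv', div_eq_mul_inv]
  have h2 := h.fderiv
  have e : (fun y => F y * Real.exp (G y * ε⁻¹)) = (F * fun x => Real.exp (G x * ε⁻¹)) := rfl
  rw [e, h2]
  simp
  ring

/-- Derivative of unnormalized averages. -/
lemma N_deriv {μ : Measure Ω} [IsProbabilityMeasure μ] {ε M B M' B' : ℝ} (hε : 0 < ε)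
    {g f : Ω → EuclideanSpace ℝ (Fin d) → ℝ}
    (hg : ∀ y, Measurable fun x => g x y) (hgb : ∀ x y, |g x y| ≤ M)
    (hgd : ∀ x, Differentiable ℝ (g x)) (hgb' : ∀ i x y, |pderiv' i (g x) y| ≤ M')
    (hf : ∀ y, Measurable fun x => f x y) (hfb : ∀ x y, |f x y| ≤ B)
    (hfd : ∀ x, Differentiable ℝ (f x)) (hfb' : ∀ i x y, |pderiv' i (f x) y| ≤ B') :
    Differentiable ℝ (fun y => ∫ x, f x y * Real.exp (g x y / ε) ∂μ) ∧
    ∀ i y, pderiv' i (fun y => ∫ x, f x y * Real.exp (g x y / ε) ∂μ) y =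
      (∫ x, pderiv' i (f x) y * Real.exp (g x y / ε) ∂μ) +
      ε⁻¹ * ∫ x, f x y * pderiv' i (g x) y * Real.exp (g x y / ε) ∂μ := by
  have b1 : ∀ i x y, |pderiv' i (f x) y * Real.exp (g x y / ε)| ≤ B' * Real.exp (M / ε) := by
    intro i x y
    rw [abs_mul]
    exact mul_le_mul (hfb' i x y) (exp_bd hε (hgb x y)) (abs_nonneg _)
      ((abs_nonneg _).trans (hfb' i x y))
  have b2 : ∀ i x y, |f x y * pderiv' i (g x) y * Real.exp (g x y / ε)|
      ≤ B * M' * Real.exp (M / ε) := by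
    intro i x y
    have hB : 0 ≤ B := (abs_nonneg _).trans (hfb x y)
    have hM' : 0 ≤ M' := (abs_nonneg _).trans (hgb' i x y)
    rw [abs_mul, abs_mul]
    exact mul_le_mul (mul_le_mul (hfb x y) (hgb' i x y) (abs_nonneg _) hB)
      (exp_bd hε (hgb x y)) (abs_nonneg _) (mul_nonneg hB hM')
  have key := int_deriv (μ := μ) (u := fun x y => f x y * Real.exp (g x y / ε))
    (B := B * Real.exp (M / ε)) (B' := B' * Real.exp (M / ε) + ε⁻¹ * (B * M' * Real.exp (M / ε)))
    (fun y => by have := hf y; have := hg y; fun_prop)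
    (fun x => by have := hfd x; have := hgd x; fun_prop)
    (fun x y => by
      rw [abs_mul]
      exact mul_le_mul (hfb x y) (exp_bd hε (hgb x y)) (abs_nonneg _)
        ((abs_nonneg _).trans (hfb x y)))
    (fun i x y => by
      rw [pderiv_fexp (hfd x) (hgd x)]
      refine (abs_add_le _ _).trans (add_le_add (b1 i x y) ?_)
      rw [abs_mul, abs_of_pos (inv_pos.2 hε)]
      exact mul_le_mul_of_nonneg_left (b2 i x y) (inv_pos.2 hε).le)
  refine ⟨key.1, fun i y => ?_⟩
  rw [key.2 i y, ← integral_const_mul]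
  have m1 := meas_pderiv hf hfd i y
  have m2 := meas_pderiv hg hgd i y
  have m3 := hf y
  have m4 := hg y
  rw [← integral_add]
  · exact integral_congr_ae (Filter.Eventually.of_forall fun x => pderiv_fexp (hfd x) (hgd x) i y)
  · exact int_bdd (by fun_prop) (b1 i · y)
  · exact (int_bdd (by fun_prop) (b2 i · y)).const_mul _

lemma Z_deriv {μ : Measure Ω} [IsProbabilityMeasure μ] {ε M M' : ℝ} (hε : 0 < ε)
    {g : Ω → EuclideanSpace ℝ (Fin d) → ℝ}
    (hg : ∀ y, Measurable fun x => g x y) (hgb : ∀ x y, |g x y| ≤ M)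
    (hgd : ∀ x, Differentiable ℝ (g x)) (hgb' : ∀ i x y, |pderiv' i (g x) y| ≤ M') :
    Differentiable ℝ (fun y => ∫ x, Real.exp (g x y / ε) ∂μ) ∧
    ∀ i y, pderiv' i (fun y => ∫ x, Real.exp (g x y / ε) ∂μ) y =
      ε⁻¹ * ∫ x, pderiv' i (g x) y * Real.exp (g x y / ε) ∂μ := by
  have h := N_deriv (μ := μ) (f := fun _ _ => 1) (B := 1) (B' := 0) hε hg hgb hgd hgb'
    (fun y => measurable_const) (by simp) (fun x => differentiable_const _) (by simp [pderiv'])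
  simpa [pderiv'] using h

lemma Ex_deriv {μ : Measure Ω} [IsProbabilityMeasure μ] {ε M B M' B' : ℝ} (hε : 0 < ε)
    {g f : Ω → EuclideanSpace ℝ (Fin d) → ℝ}
    (hg : ∀ y, Measurable fun x => g x y) (hgb : ∀ x y, |g x y| ≤ M)
    (hgd : ∀ x, Differentiable ℝ (g x)) (hgb' : ∀ i x y, |pderiv' i (g x) y| ≤ M')
    (hf : ∀ y, Measurable fun x => f x y) (hfb : ∀ x y, |f x y| ≤ B)
    (hfd : ∀ x, Differentiable ℝ (f x)) (hfb' : ∀ i x y, |pderiv' i (f x) y| ≤ B') :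
    Differentiable ℝ (Ex μ ε g f) ∧
    ∀ i, pderiv' i (Ex μ ε g f) = fun y => Ex μ ε g (fun x => pderiv' i (f x)) y +
      ε⁻¹ * (Ex μ ε g (fun x y => f x y * pderiv' i (g x) y) y +
        (-1) * (Ex μ ε g f y * Ex μ ε g (fun x => pderiv' i (g x)) y)) := by
  obtain ⟨n1, n2⟩ := N_deriv (μ := μ) hε hg hgb hgd hgb' hf hfb hfd hfb'
  obtain ⟨z1, z2⟩ := Z_deriv (μ := μ) hε hg hgb hgd hgb'
  have hZ : ∀ y, 0 < ∫ x, Real.exp (g x y / ε) ∂μ :=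
    fun y => Z_pos (μ := μ) hε (hg y) (fun x => hgb x y)
  have hd : ∀ y, HasFDerivAt (Ex μ ε g f) _ y := fun y =>
    (n1 y).hasFDerivAt.mul ((hasDerivAt_inv (hZ y).ne').comp_hasFDerivAt y (z1 y).hasFDerivAt)
  refine ⟨fun y => (hd y).differentiableAt, fun i => ?_⟩
  funext y
  have hz := (hZ y).ne'
  have e := n2 i y
  have e' := z2 i y
  unfold pderiv' at e e'
  conv_lhs => unfold pderiv'
  rw [(hd y).fderiv]
  simp only [ContinuousLinearMap.add_apply, ContinuousLinearMap.smul_apply, smul_eq_mul, e, e',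
    Function.comp]
  unfold Ex pderiv'
  simp only
  field_simp
  ring

lemma Ex_Bd (M : ℝ) (k : ℕ) : ∀ B : ℝ, ∃ C : ℝ, 0 ≤ C ∧
    ∀ (μ : Measure Ω), IsProbabilityMeasure μ → ∀ ε : ℝ, 0 < ε →
    ∀ g f : Ω → EuclideanSpace ℝ (Fin d) → ℝ,
      (∀ y, Measurable fun x => g x y) → (∀ x, Bd 1 k M (g x)) →
      (∀ y, Measurable fun x => f x y) → (∀ x, Bd 1 k B (f x)) →
      Bd (1 + ε⁻¹) k C (Ex μ ε g f) := by
  induction k with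
  | zero =>
    intro B
    refine ⟨|B|, abs_nonneg _, ?_⟩
    intro μ _ ε hε g f hg hgB hf hfB
    have hgb : ∀ x y, |g x y| ≤ M := fun x => (hgB x).bound
    have hfb : ∀ x y, |f x y| ≤ B := fun x => (hfB x).bound
    refine ⟨?_, fun y => (Ex_bound hε hg hgb hfb y).trans (le_abs_self _)⟩
    refine Continuous.div ?_ ?_ fun y => (Z_pos (μ := μ) hε (hg y) (fun x => hgb x y)).ne'
    · refine int_cont (B := B * Real.exp (M / ε))
        (fun y => by have := hf y; have := hg y; fun_prop)
        (fun x => by have := (hfB x).1; have := (hgB x).1; fun_prop) (fun x y => ?_)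
      rw [abs_mul]
      exact mul_le_mul (hfb x y) (exp_bd hε (hgb x y)) (abs_nonneg _)
        ((abs_nonneg _).trans (hfb x y))
    · exact int_cont (B := Real.exp (M / ε))
        (fun y => by have := hg y; fun_prop)
        (fun x => by have := (hgB x).1; fun_prop) (fun x y => exp_bd hε (hgb x y))
  | succ k ih =>
    intro B
    obtain ⟨C1, h1, H1⟩ := ih B
    obtain ⟨C2, h2, H2⟩ := ih (2 ^ k * (B * M))
    obtain ⟨C3, h3, H3⟩ := ih M
    refine ⟨|B| + (C1 + (C2 + 2 ^ k * (C1 * C3))), by positivity, ?_⟩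
    intro μ hμ ε hε g f hg hgB hf hfB
    have hgb : ∀ x y, |g x y| ≤ M := fun x => (hgB x).bound
    have hfb : ∀ x y, |f x y| ≤ B := fun x => (hfB x).bound
    have hgd := fun x => (hgB x).1
    have hfd := fun x => (hfB x).1
    have hg2 : ∀ i x, Bd 1 k M (pderiv' i (g x)) := fun i x => by
      simpa using (hgB x).2.2 i
    have hf2 : ∀ i x, Bd 1 k B (pderiv' i (f x)) := fun i x => by
      simpa using (hfB x).2.2 i
    obtain ⟨D1, D2⟩ := Ex_deriv (μ := μ) hε hg hgb hgd (fun i x => (hg2 i x).bound)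
      hf hfb hfd (fun i x => (hf2 i x).bound)
    have hε' := inv_pos.2 hε
    refine ⟨D1, fun y => ?_, fun i => ?_⟩
    · refine (Ex_bound hε hg hgb hfb y).trans ((le_abs_self _).trans ?_)
      have : 0 ≤ C1 + (C2 + 2 ^ k * (C1 * C3)) := by positivity
      linarith
    · rw [D2 i]
      have mg := meas_pderiv hg hgd i
      have mf := meas_pderiv hf hfd i
      have t1 := H1 μ hμ ε hε g _ hg (fun x => (hgB x).down) mf (hf2 i)
      have t2 := H2 μ hμ ε hε g (fun x y => f x y * pderiv' i (g x) y) hg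
        (fun x => (hgB x).down) (fun y => (hf y).mul (mg y))
        (fun x => (hfB x).down.mul (hg2 i x))
      have t3 := H1 μ hμ ε hε g f hg (fun x => (hgB x).down) hf (fun x => (hfB x).down)
      have t4 := H3 μ hμ ε hε g _ hg (fun x => (hgB x).down) mg (hg2 i)
      refine (t1.add ((t2.add ((t3.mul t4).smul (-1))).smul ε⁻¹)).mono (by positivity) ?_
      rw [abs_of_pos hε']
      simp only [abs_neg, abs_one, one_mul]
      have : 0 ≤ |B| * (1 + ε⁻¹) := by positivity
      have : 0 ≤ C1 * ε⁻¹ := by positivity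
      have : 0 ≤ C2 + 2 ^ k * (C1 * C3) := by positivity
      nlinarith

lemma pow_w_le {ε : ℝ} (hε : 0 < ε) {j k : ℕ} (hj : j ≤ k) :
    (1 + ε⁻¹) ^ j ≤ 2 ^ k * (1 + ε ^ ((1:ℝ) - ((k + 1 : ℕ) : ℝ))) := by
  have e : ε ^ ((1:ℝ) - ((k + 1 : ℕ) : ℝ)) = ε⁻¹ ^ k := by
    rw [show (1:ℝ) - ((k + 1 : ℕ) : ℝ) = -(k:ℝ) by push_cast; ring, Real.rpow_neg hε.le,
      Real.rpow_natCast, inv_pow]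
  rw [e]
  have hi := inv_pos.2 hε
  have h1 : (1 + ε⁻¹) ^ j ≤ (1 + ε⁻¹) ^ k := pow_le_pow_right₀ (by linarith) hj
  refine h1.trans ?_
  rcases le_total ε⁻¹ 1 with h | h
  · calc (1 + ε⁻¹) ^ k ≤ 2 ^ k := by gcongr; linarith
      _ ≤ _ := le_mul_of_one_le_right (by positivity) (by linarith [pow_pos hi k])
  · calc (1 + ε⁻¹) ^ k ≤ (2 * ε⁻¹) ^ k := by gcongr; linarith
      _ = 2 ^ k * ε⁻¹ ^ k := mul_pow _ _ _
      _ ≤ _ := by gcongr; linarith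

end helpers

/-- Softmin regularity: there is `C = C(s,d,M)` such that for every compact `𝒳`, probability
measure `μ` on `𝒳`, `ε > 0`, and `g` continuous in `x` and `s`-times continuously
differentiable in `y` with all `y`-derivatives of order `≤ s` bounded by `M`, the softmin
`h(y) = -ε log ∫ exp(g(x,y)/ε) dμ(x)` is `s`-times continuously differentiable and all its
iterated partial derivatives of order `1 ≤ |α| ≤ s` are bounded by `C (1 + ε^{1-s})`. -/
theorem stmt_17 (s d : ℕ) (M : ℝ) :
    ∃ C : ℝ, ∀ (X : Set (EuclideanSpace ℝ (Fin d))), IsCompact X →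
      ∀ (μ : Measure (EuclideanSpace ℝ (Fin d))), IsProbabilityMeasure μ → μ X = 1 →
      ∀ ε : ℝ, 0 < ε →
      ∀ g : EuclideanSpace ℝ (Fin d) → EuclideanSpace ℝ (Fin d) → ℝ,
      (∀ y, Continuous fun x => g x y) →
      (∀ x, ContDiff ℝ (s : ℕ∞) fun y => g x y) →
      (∀ x y, ∀ L : List (Fin d), L.length ≤ s → |(L.foldr pderiv' (g x)) y| ≤ M) →
      ContDiff ℝ (s : ℕ∞) (fun y => -ε * Real.log (∫ x, Real.exp (g x y / ε) ∂μ))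
      ∧ ∀ L : List (Fin d), 1 ≤ L.length → L.length ≤ s →
          ∀ y, |(L.foldr pderiv'
                  (fun y => -ε * Real.log (∫ x, Real.exp (g x y / ε) ∂μ))) y|
            ≤ C * (1 + ε ^ ((1 : ℝ) - (s : ℝ))) := by
  cases s with
  | zero =>
    refine ⟨0, ?_⟩
    intro X _ μ hμ _ ε hε g hgc hgd hgb
    refine ⟨?_, fun L h1 h2 => by omega⟩
    have hb : ∀ x y, |g x y| ≤ M := fun x y => hgb x y [] (by simp)
    have hg : ∀ y, Measurable fun x => g x y := fun y => (hgc y).measurable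
    have hc : Continuous fun y => ∫ x, Real.exp (g x y / ε) ∂μ :=
      int_cont (B := Real.exp (M / ε)) (fun y => by have := hg y; fun_prop)
        (fun x => by have := (hgd x).continuous; fun_prop) (fun x y => exp_bd hε (hb x y))
    have : Continuous (fun y => -ε * Real.log (∫ x, Real.exp (g x y / ε) ∂μ)) :=
      continuous_const.mul (hc.log fun y => (Z_pos (μ := μ) hε (hg y) (fun x => hb x y)).ne')
    simpa using this
  | succ k =>
    obtain ⟨C, hC, H⟩ := Ex_Bd (Ω := EuclideanSpace ℝ (Fin d)) (d := d) M k M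
    refine ⟨C * 2 ^ k, ?_⟩
    intro X _ μ hμ _ ε hε g hgc hgd hgb
    have hg : ∀ y, Measurable fun x => g x y := fun y => (hgc y).measurable
    have hgB : ∀ x, Bd 1 (k+1) M (g x) := fun x => Bd.of_list (hgd x) (hgb x)
    have hb : ∀ x y, |g x y| ≤ M := fun x => (hgB x).bound
    have hgd' := fun x => (hgB x).1
    have hg2 : ∀ i x, Bd 1 k M (pderiv' i (g x)) := fun i x => by
      simpa using (hgB x).2.2 i
    obtain ⟨z1, z2⟩ := Z_deriv (μ := μ) hε hg hb hgd' (fun i x => (hg2 i x).bound)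
    have hZ : ∀ y, (∫ x, Real.exp (g x y / ε) ∂μ) ≠ 0 :=
      fun y => (Z_pos (μ := μ) hε (hg y) (fun x => hb x y)).ne'
    have hd : ∀ y, HasFDerivAt (fun y => -ε * Real.log (∫ x, Real.exp (g x y / ε) ∂μ)) _ y :=
      fun y => ((z1 y).hasFDerivAt.log (hZ y)).const_mul (-ε)
    have hp : ∀ i, pderiv' i (fun y => -ε * Real.log (∫ x, Real.exp (g x y / ε) ∂μ)) =
        fun y => (-1) * Ex μ ε g (fun x => pderiv' i (g x)) y := by
      intro i
      funext y
      have e' := z2 i y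
      have hz := hZ y
      unfold pderiv' at e'
      conv_lhs => unfold pderiv'
      rw [(hd y).fderiv]
      simp only [ContinuousLinearMap.smul_apply, smul_eq_mul, e']
      unfold Ex pderiv'
      simp only
      field_simp
    have hBd : ∀ i, Bd (1 + ε⁻¹) k C
        (pderiv' i (fun y => -ε * Real.log (∫ x, Real.exp (g x y / ε) ∂μ))) := by
      intro i
      rw [hp i]
      have := (H μ hμ ε hε g _ hg (fun x => (hgB x).down) (meas_pderiv hg hgd' i)
        (hg2 i)).smul (-1)
      simpa using this
    refine ⟨contDiff_of_pderiv (fun y => (hd y).differentiableAt) fun i => (hBd i).contDiff, ?_⟩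
    intro L h1 h2 y
    rcases List.eq_nil_or_concat L with rfl | ⟨L', i, rfl⟩
    · simp at h1
    · have hl : L'.length ≤ k := by simpa using h2
      have := (hBd i).list L' hl y
      simp only [List.concat_eq_append, List.foldr_append, List.foldr_cons, List.foldr_nil]
      refine this.trans ?_
      rw [mul_assoc]
      exact mul_le_mul_of_nonneg_left (pow_w_le hε hl) hC
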